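/- Let n, h, H be as in the grid-interpolation setup, and define H̃(τ,θ) = (1−z(τ))(1−z(θ))·H(τ̄,θ̄) + (1−z(τ))z(θ)·H(τ̄,θ̂) + z(τ)(1−z(θ))·H(τ̂,θ̄) + z(τ)z(θ)·H(τ̂,θ̂). Then for all 0 ≤ τ ≤ θ ≤ 1: H(τ,θ) ≥ H̃(τ,θ) − 5/(2n²). -/

import Mathlib

/-- Lower grid point: `x̄ = ⌊nx⌋/n` for `x ∈ [0,1)`, and `1̄ = 1`. -/
noncomputable def gbar (n : ℕ) (x : ℝ) : ℝ :=
  if x = 1 then 1 else (⌊(n : ℝ) * x⌋ : ℝ) / n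

/-- Upper grid point: `x̂ = x̄ + 1/n` for `x ∈ [0,1)`, and `1̂ = 1`. -/
noncomputable def ghat (n : ℕ) (x : ℝ) : ℝ :=
  if x = 1 then 1 else (⌊(n : ℝ) * x⌋ : ℝ) / n + 1 / n

/-- Interpolation weight: `z(x) = n·(x − x̄)` for `x ∈ [0,1)`, and `z(1) = 0`. -/
noncomputable def gz (n : ℕ) (x : ℝ) : ℝ :=
  if x = 1 then 0 else (n : ℝ) * (x - (⌊(n : ℝ) * x⌋ : ℝ) / n)

/-- `H(τ,θ) = θ·h(τ,θ) − ∫_τ^θ h(τ,y) dy` (signed integral). -/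
noncomputable def gridH (h : ℝ → ℝ → ℝ) (τ θ : ℝ) : ℝ :=
  θ * h τ θ - ∫ y in τ..θ, h τ y

/-- Bilinear interpolation of a two-variable function at the grid corners. -/
noncomputable def interp2 (n : ℕ) (F : ℝ → ℝ → ℝ) (τ θ : ℝ) : ℝ :=
  (1 - gz n τ) * (1 - gz n θ) * F (gbar n τ) (gbar n θ)
  + (1 - gz n τ) * gz n θ * F (gbar n τ) (ghat n θ)
  + gz n τ * (1 - gz n θ) * F (ghat n τ) (gbar n θ)
  + gz n τ * gz n θ * F (ghat n τ) (ghat n θ)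

/-- On each closed grid cell, including its right endpoint, the weights `gz` interpolate the
values at the two ends of the cell. -/
theorem gz_lerp_eq {n i : ℕ} (hi : i < n) {s : ℝ} (hs0 : 0 ≤ s) (hs1 : s ≤ 1) (f : ℝ → ℝ) :
    (1 - gz n ((i + s) / n)) * f (gbar n ((i + s) / n))
        + gz n ((i + s) / n) * f (ghat n ((i + s) / n))
      = (1 - s) * f (i / n) + s * f ((i + 1) / n) := by
  have hn : (0 : ℝ) < n := by exact_mod_cast (Nat.zero_le i).trans_lt hi
  have hi' : (i : ℝ) + 1 ≤ n := by exact_mod_cast hi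
  have hmul : (n : ℝ) * ((i + s) / n) = i + s := by field_simp
  rcases hs1.lt_or_eq with hs | rfl
  · have hne : ((i : ℝ) + s) / n ≠ 1 := by
      rw [Ne, div_eq_one_iff_eq hn.ne']
      linarith
    have hfl : ⌊(i : ℝ) + s⌋ = (i : ℤ) := by
      rw [Int.floor_eq_iff]
      constructor <;> push_cast <;> linarith
    have hz : (n : ℝ) * ((i + s) / n - i / n) = s := by field_simp; ring
    simp only [gz, gbar, ghat, if_neg hne, hmul, hfl, Int.cast_natCast, hz, ← add_div]
  · by_cases h1 : ((i : ℝ) + 1) / n = 1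
    · simp [gz, gbar, h1]
    · have hfl : ⌊(i : ℝ) + 1⌋ = (i : ℤ) + 1 := by simp
      simp only [gz, gbar, if_neg h1, hmul, hfl]
      push_cast
      simp

/-- Every point of `[0, 1]` lies in a closed grid cell. -/
theorem exists_grid_cell {n : ℕ} (hn : 0 < n) {x : ℝ} (hx : x ∈ Set.Icc (0 : ℝ) 1) :
    ∃ i : ℕ, i < n ∧ ∃ s : ℝ, 0 ≤ s ∧ s ≤ 1 ∧ x = (i + s) / n := by
  have hn' : (0 : ℝ) < n := by exact_mod_cast hn
  obtain ⟨hx0, hx1⟩ := hx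
  rcases hx1.lt_or_eq with hlt | rfl
  · have hnx : 0 ≤ (n : ℝ) * x := by positivity
    refine ⟨⌊(n : ℝ) * x⌋₊, ?_, n * x - ⌊(n : ℝ) * x⌋₊, ?_, ?_, ?_⟩
    · rw [Nat.floor_lt hnx]
      nlinarith
    · linarith [Nat.floor_le hnx]
    · linarith [Nat.lt_floor_add_one ((n : ℝ) * x)]
    · field_simp
      ring
  · refine ⟨n - 1, by omega, 1, zero_le_one, le_rfl, ?_⟩
    rw [Nat.cast_sub hn]
    field_simp
    simp

theorem grid_cell_mem_Icc {n i : ℕ} (hi : i < n) {s : ℝ} (hs0 : 0 ≤ s) (hs1 : s ≤ 1) :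
    ((i : ℝ) + s) / n ∈ Set.Icc (0 : ℝ) 1 := by
  have hi' : (i : ℝ) + 1 ≤ n := by exact_mod_cast hi
  exact ⟨by positivity, div_le_one_of_le₀ (by linarith) (by positivity)⟩

/-- Interpolating `F` at a point of a grid cell, one variable at a time. -/
theorem interp2_grid_cell {n i j : ℕ} (hi : i < n) (hj : j < n) {s t : ℝ} (hs0 : 0 ≤ s)
    (hs1 : s ≤ 1) (ht0 : 0 ≤ t) (ht1 : t ≤ 1) (F : ℝ → ℝ → ℝ) :
    interp2 n F ((i + s) / n) ((j + t) / n)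
      = (1 - s) * ((1 - t) * F (i / n) (j / n) + t * F (i / n) ((j + 1) / n))
        + s * ((1 - t) * F ((i + 1) / n) (j / n) + t * F ((i + 1) / n) ((j + 1) / n)) := by
  rw [← gz_lerp_eq hj ht0 ht1 (F (i / n)), ← gz_lerp_eq hj ht0 ht1 (F ((i + 1) / n)),
    ← gz_lerp_eq hi hs0 hs1 (fun x => (1 - gz n ((j + t) / n)) * F x (gbar n ((j + t) / n))
      + gz n ((j + t) / n) * F x (ghat n ((j + t) / n)))]
  simp only [interp2]
  ring

/-- If `f` is affine on `[c, c + w]`, then so is `y ↦ y * f y - ∫ f` up to a quadratic defect. -/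
theorem mul_sub_integral_lerp {f : ℝ → ℝ} {a c w : ℝ} (hw : 0 < w)
    (hintegrable : IntervalIntegrable f MeasureTheory.volume a c)
    (haff : ∀ t, 0 ≤ t → t ≤ 1 → f (c + t * w) = (1 - t) * f c + t * f (c + w))
    {t : ℝ} (ht0 : 0 ≤ t) (ht1 : t ≤ 1) :
    (c + t * w) * f (c + t * w) - ∫ y in a..c + t * w, f y
      = (1 - t) * (c * f c - ∫ y in a..c, f y)
        + t * ((c + w) * f (c + w) - ∫ y in a..c + w, f y)
        - t * (1 - t) / 2 * w * (f (c + w) - f c) := by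
  have heq : ∀ u, 0 ≤ u → u ≤ 1 → Set.EqOn f
      (fun y => (f c - c * ((f (c + w) - f c) / w)) + (f (c + w) - f c) / w * y)
      (Set.uIcc c (c + u * w)) := by
    intro u hu0 hu1 y hy
    rw [Set.uIcc_of_le (by nlinarith)] at hy
    have h1 : y = c + (y - c) / w * w := by field_simp; ring
    have h2 := haff ((y - c) / w) (div_nonneg (by linarith [hy.1]) hw.le)
      ((div_le_one hw).2 (by nlinarith [hy.2]))
    rw [← h1] at h2
    rw [h2]
    field_simp
    ring
  have hI : ∀ u, 0 ≤ u → u ≤ 1 → ∫ y in a..c + u * w, f y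
      = (∫ y in a..c, f y) + (u * w * f c + u ^ 2 / 2 * w * (f (c + w) - f c)) := by
    intro u hu0 hu1
    have hcu : IntervalIntegrable f MeasureTheory.volume c (c + u * w) :=
      ContinuousOn.intervalIntegrable
        (ContinuousOn.congr (by fun_prop) (heq u hu0 hu1))
    rw [← intervalIntegral.integral_add_adjacent_intervals hintegrable hcu,
      intervalIntegral.integral_congr (heq u hu0 hu1),
      intervalIntegral.integral_add (Continuous.intervalIntegrable (by fun_prop) _ _)
        (Continuous.intervalIntegrable (by fun_prop) _ _),
      intervalIntegral.integral_const_mul, intervalIntegral.integral_const, integral_id,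
      smul_eq_mul]
    field_simp
    ring
  have hI1 := hI 1 zero_le_one le_rfl
  rw [one_mul] at hI1
  rw [hI t ht0 ht1, hI1, haff t ht0 ht1]
  ring

/-- **Full bilinear interpolation bound for `H`.**
For `h` equal to the bilinear interpolation of its grid values, nondecreasing in each
coordinate and step-Lipschitz at grid points, and `H̃` the bilinear interpolation of
`H` at the grid corners, for all `0 ≤ τ ≤ θ ≤ 1`: `H(τ,θ) ≥ H̃(τ,θ) − 5/(2n²)`. -/
theorem gridH_interp_full
    (n : ℕ) (hn : 0 < n) (h : ℝ → ℝ → ℝ)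
    (hinterp : ∀ τ ∈ Set.Icc (0:ℝ) 1, ∀ θ ∈ Set.Icc (0:ℝ) 1,
      h τ θ = (1 - gz n τ) * (1 - gz n θ) * h (gbar n τ) (gbar n θ)
        + (1 - gz n τ) * gz n θ * h (gbar n τ) (ghat n θ)
        + gz n τ * (1 - gz n θ) * h (ghat n τ) (gbar n θ)
        + gz n τ * gz n θ * h (ghat n τ) (ghat n θ))
    (hmono_left : ∀ θ ∈ Set.Icc (0:ℝ) 1, MonotoneOn (fun τ => h τ θ) (Set.Icc 0 1))
    (hmono_right : ∀ τ ∈ Set.Icc (0:ℝ) 1, MonotoneOn (fun θ => h τ θ) (Set.Icc 0 1))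
    (hlip_right : ∀ i j : ℕ, i ≤ n → j + 1 ≤ n →
      h ((i:ℝ)/n) (((j:ℝ)+1)/n) ≤ h ((i:ℝ)/n) ((j:ℝ)/n) + 4 / n)
    (hlip_left : ∀ i j : ℕ, i + 1 ≤ n → j ≤ n →
      h (((i:ℝ)+1)/n) ((j:ℝ)/n) ≤ h ((i:ℝ)/n) ((j:ℝ)/n) + 4 / n)
    (τ θ : ℝ) (hτ0 : 0 ≤ τ) (hτθ : τ ≤ θ) (hθ1 : θ ≤ 1) :
    interp2 n (gridH h) τ θ - 5 / (2 * (n:ℝ)^2) ≤ gridH h τ θ := by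

  have hn' : (0 : ℝ) < n := by exact_mod_cast hn
  obtain ⟨i, hi, s, hs0, hs1, rfl⟩ := exists_grid_cell hn ⟨hτ0, hτθ.trans hθ1⟩
  obtain ⟨j, hj, t, ht0, ht1, rfl⟩ := exists_grid_cell hn ⟨hτ0.trans hτθ, hθ1⟩
  have hcell : ∀ k < n, ∀ u, 0 ≤ u → u ≤ 1 → ∀ l < n, ∀ v, 0 ≤ v → v ≤ 1 →
      h ((k + u) / n) ((l + v) / n)
        = (1 - u) * ((1 - v) * h (k / n) (l / n) + v * h (k / n) ((l + 1) / n))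
        + u * ((1 - v) * h ((k + 1) / n) (l / n) + v * h ((k + 1) / n) ((l + 1) / n)) := by
    intro k hk u hu0 hu1 l hl v hv0 hv1
    rw [← interp2_grid_cell hk hl hu0 hu1 hv0 hv1]
    exact hinterp _ (grid_cell_mem_Icc hk hu0 hu1) _ (grid_cell_mem_Icc hl hv0 hv1)
  set a : ℝ := i / n with ha
  set b : ℝ := (i + 1) / n with hb
  have hmem_a : a ∈ Set.Icc (0 : ℝ) 1 := by simpa using grid_cell_mem_Icc hi le_rfl zero_le_one
  have hmem_b : b ∈ Set.Icc (0 : ℝ) 1 := grid_cell_mem_Icc hi zero_le_one le_rfl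
  have hmem_x := grid_cell_mem_Icc hi hs0 hs1
  have hmem_c : (j / n : ℝ) ∈ Set.Icc (0 : ℝ) 1 := by
    simpa using grid_cell_mem_Icc hj le_rfl zero_le_one
  have hmem_y := grid_cell_mem_Icc hj ht0 ht1
  set x : ℝ := (i + s) / n with hx
  have hxa : x = a + s * (1 / n) := by rw [hx, ha]; field_simp
  have hbx : b = x + (1 - s) * (1 / n) := by rw [hx, hb]; field_simp; ring
  have hrow_a : ∀ l < n, ∀ v, 0 ≤ v → v ≤ 1 →
      h a ((l + v) / n) = (1 - v) * h a (l / n) + v * h a ((l + 1) / n) := by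
    intro l hl v hv0 hv1
    have := hcell i hi 0 le_rfl zero_le_one l hl v hv0 hv1
    simpa [← ha] using this
  have hrow_b : ∀ l < n, ∀ v, 0 ≤ v → v ≤ 1 →
      h b ((l + v) / n) = (1 - v) * h b (l / n) + v * h b ((l + 1) / n) := by
    intro l hl v hv0 hv1
    have := hcell i hi 1 zero_le_one le_rfl l hl v hv0 hv1
    simpa [← hb] using this
  have hcol : ∀ y ∈ Set.Icc (0 : ℝ) 1, h x y = (1 - s) * h a y + s * h b y := by
    intro y hy
    obtain ⟨l, hl, v, hv0, hv1, rfl⟩ := exists_grid_cell hn hy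
    rw [hcell i hi s hs0 hs1 l hl v hv0 hv1, hrow_a l hl v hv0 hv1, hrow_b l hl v hv0 hv1]
  have hintegrable : ∀ p ∈ Set.Icc (0 : ℝ) 1, ∀ u ∈ Set.Icc (0 : ℝ) 1, ∀ v ∈ Set.Icc (0 : ℝ) 1,
      IntervalIntegrable (h p) MeasureTheory.volume u v := fun p hp u hu v hv =>
    ((hmono_right p hp).mono (Set.uIcc_subset_Icc hu hv)).intervalIntegrable
  have hrow_bound : ∀ p ∈ Set.Icc (0 : ℝ) 1,
      (∀ v, 0 ≤ v → v ≤ 1 →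
        h p ((j + v) / n) = (1 - v) * h p (j / n) + v * h p ((j + 1) / n)) →
      h p ((j + 1) / n) ≤ h p (j / n) + 4 / n →
      (1 - t) * gridH h p (j / n) + t * gridH h p ((j + 1) / n) - 1 / (2 * (n : ℝ) ^ 2)
        ≤ gridH h p ((j + t) / n) := by
    intro p hp haff hstep
    have e : ∀ v : ℝ, (j : ℝ) / n + v * (1 / n) = (j + v) / n := fun v => by field_simp
    have e1 : (j : ℝ) / n + 1 / n = (j + 1) / n := by rw [← e, one_mul]
    have key := mul_sub_integral_lerp (f := h p) (a := p) (c := j / n) (w := 1 / n)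
      (by positivity) (hintegrable p hp p hp _ hmem_c)
      (fun v hv0 hv1 => by rw [e, e1]; exact haff v hv0 hv1) ht0 ht1
    rw [e, e1] at key
    unfold gridH
    rw [key]
    have h1 : t * (1 - t) / 2 * (1 / n) * (h p ((j + 1) / n) - h p (j / n))
        ≤ t * (1 - t) / 2 * (1 / n) * (4 / n) := by
      have : 0 ≤ 1 - t := by linarith
      gcongr
      linarith
    have h2 : t * (1 - t) / 2 * (1 / n) * (4 / n) ≤ 1 / (2 * (n : ℝ) ^ 2) := by
      rw [show t * (1 - t) / 2 * (1 / n) * (4 / n) = (4 * (t * (1 - t))) / (2 * (n : ℝ) ^ 2) by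
        field_simp]
      gcongr
      nlinarith [sq_nonneg (2 * t - 1)]
    linarith
  have hA := hrow_bound a hmem_a (hrow_a j hj) (hlip_right i j hi.le hj)
  have hB := hrow_bound b hmem_b (hrow_b j hj)
    (by have := hlip_right (i + 1) j hi hj; push_cast at this; exact this)
  set y : ℝ := (j + t) / n
  have hax : a ≤ x := by rw [hxa]; simp; positivity
  have hxb : x ≤ b := by
    rw [hbx]
    have : 0 ≤ 1 - s := by linarith
    simp only [le_add_iff_nonneg_right]
    positivity
  have hsplit : ∫ v in x..y, h x v
      = (1 - s) * ((∫ v in a..y, h a v) - ∫ v in a..x, h a v)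
        + s * ((∫ v in b..y, h b v) + ∫ v in x..b, h b v) := by
    rw [intervalIntegral.integral_congr (g := fun v => (1 - s) * h a v + s * h b v)
        (fun v hv => hcol v (Set.uIcc_subset_Icc hmem_x hmem_y hv)),
      intervalIntegral.integral_add ((hintegrable a hmem_a x hmem_x y hmem_y).const_mul _)
        ((hintegrable b hmem_b x hmem_x y hmem_y).const_mul _),
      intervalIntegral.integral_const_mul, intervalIntegral.integral_const_mul,
      intervalIntegral.integral_interval_sub_left (hintegrable a hmem_a a hmem_a y hmem_y)
        (hintegrable a hmem_a a hmem_a x hmem_x),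
      add_comm (∫ v in b..y, h b v), intervalIntegral.integral_add_adjacent_intervals
        (hintegrable b hmem_b x hmem_x b hmem_b) (hintegrable b hmem_b b hmem_b y hmem_y)]
  have hlow : s * (1 / n) * h a a ≤ ∫ v in a..x, h a v := by
    have := intervalIntegral.integral_mono_on hax intervalIntegrable_const
      (hintegrable a hmem_a a hmem_a x hmem_x) (f := fun _ => h a a) (fun v hv =>
        hmono_right a hmem_a hmem_a ⟨hmem_a.1.trans hv.1, hv.2.trans hmem_x.2⟩ hv.1)
    rwa [intervalIntegral.integral_const, smul_eq_mul,
      show x - a = s * (1 / n) by linarith] at this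
  have hupp : ∫ v in x..b, h b v ≤ (1 - s) * (1 / n) * h b b := by
    have := intervalIntegral.integral_mono_on hxb (hintegrable b hmem_b x hmem_x b hmem_b)
      intervalIntegrable_const (g := fun _ => h b b) (fun v hv =>
        hmono_right b hmem_b ⟨hmem_x.1.trans hv.1, hv.2.trans hmem_b.2⟩ hmem_b hv.2)
    rwa [intervalIntegral.integral_const, smul_eq_mul,
      show b - x = (1 - s) * (1 / n) by linarith] at this
  have hdiag : h b b ≤ h a a + 8 / n := by
    have h1 := hlip_right i i hi.le hi
    have h2 := hlip_left i (i + 1) hi hi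
    push_cast at h2
    rw [show (8 : ℝ) / n = 4 / n + 4 / n by ring]
    linarith
  have hdefect : s * (1 - s) * (1 / n) * (h b b - h a a) ≤ 2 / (n : ℝ) ^ 2 := by
    have hs' : 0 ≤ 1 - s := by linarith
    calc s * (1 - s) * (1 / n) * (h b b - h a a) ≤ s * (1 - s) * (1 / n) * (8 / n) := by
          gcongr
          linarith
      _ = 8 * (s * (1 - s)) / (n : ℝ) ^ 2 := by field_simp
      _ ≤ 2 / (n : ℝ) ^ 2 := by
          gcongr
          nlinarith [sq_nonneg (2 * s - 1)]
  rw [interp2_grid_cell hi hj hs0 hs1 ht0 ht1, ← ha, ← hb]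
  have hA' := mul_le_mul_of_nonneg_left hA (sub_nonneg.2 hs1)
  have hB' := mul_le_mul_of_nonneg_left hB hs0
  have hlow' := mul_le_mul_of_nonneg_left hlow (sub_nonneg.2 hs1)
  have hupp' := mul_le_mul_of_nonneg_left hupp hs0
  have hgrid : gridH h x y = (1 - s) * gridH h a y + s * gridH h b y
      + (1 - s) * (∫ v in a..x, h a v) - s * ∫ v in x..b, h b v := by
    simp only [gridH]
    rw [hsplit, hcol y hmem_y]
    ring
  have hsum : 5 / (2 * (n : ℝ) ^ 2) = 1 / (2 * (n : ℝ) ^ 2) + 2 / (n : ℝ) ^ 2 := by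
    field_simp
    norm_num
  rw [hgrid, hsum]
  linarith
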